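/- (Corollary 1, bound (cor002).) Assume the intensities are time-independent, the off-diagonal entries of D B D⁻¹ are nonnegative, α = inf_i α_i > 0, and W* := inf_{k≥1} (d_1 + ... + d_k)/k > 0. Let π be a stationary stochastic vector, let F = Σ_{k≥1} d_k Σ_{i≥k} a_{i0} < ∞, let φ = Σ_{j≥1} j·π_j be the stationary mean, and let p be the solution of the forward Kolmogorov system with p(0) = e_0, with mean E(t,0) = Σ_{j≥1} j·p_j(t). Then |φ − E(t,0)| ≤ (F/(α·W*))·e^{−αt} for all t ≥ 0. -/

import Mathlib

open MeasureTheory intervalIntegral Filter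
open scoped Topology

noncomputable section

/-- `p : ℝ → ℕ → ℝ` is a solution of the forward Kolmogorov system `dp/dt = A p(t)` for a
homogeneous chain with constant transposed intensity matrix `a`: each `p t` (for `t ≥ 0`)
is a stochastic vector and the integral form
`p_i(t) = p_i(s) + ∫_s^t Σ_j a_{ij} p_j(u) du` of the equations holds. -/
def IsKolmogorovSolution (a : ℕ → ℕ → ℝ) (p : ℝ → ℕ → ℝ) : Prop :=
  (∀ t : ℝ, 0 ≤ t → (∀ i, 0 ≤ p t i) ∧ HasSum (p t) 1) ∧
  (∀ i : ℕ, ∀ s t : ℝ, 0 ≤ s → s ≤ t →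
    p t i = p s i + ∫ u in s..t, ∑' j : ℕ, a i j * p u j)

/-- The weighted norm `‖w‖_{1D} = Σ_{k≥1} d_k |Σ_{i≥k} w_i|` (the coordinate `w 0` is not
used, and `d k` only matters for `k ≥ 1`). -/
def norm1D (d : ℕ → ℝ) (w : ℕ → ℝ) : ℝ :=
  ∑' k : ℕ, d (k + 1) * |∑' i : ℕ, w (k + 1 + i)|

/-- Summability of the series defining `‖w‖_{1D}`, i.e. `‖w‖_{1D} < ∞`. -/
def Norm1DFinite (d : ℕ → ℝ) (w : ℕ → ℝ) : Prop :=
  Summable (fun k : ℕ => d (k + 1) * |∑' i : ℕ, w (k + 1 + i)|)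

/-- Entries `b_{ij} = a_{ij} − a_{i0}` of the reduced matrix `B` (for `i, j ≥ 1`), with
the convention `b_{k,0} := 0`. -/
def bEntry (a : ℕ → ℕ → ℝ) (i j : ℕ) : ℝ :=
  if j = 0 then 0 else a i j - a i 0

/-- Entries `b*_{ij} = (d_i/d_j) Σ_{k≥i} (b_{kj} − b_{k,j−1})` of `D B D⁻¹`. -/
def bStar (d : ℕ → ℝ) (a : ℕ → ℕ → ℝ) (i j : ℕ) : ℝ :=
  (d i / d j) * ∑' k : ℕ, (bEntry a (i + k) j - bEntry a (i + k) (j - 1))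

/-- `α_i = −Σ_{j≥1} b*_{ji}`. -/
def alphaI (d : ℕ → ℝ) (a : ℕ → ℕ → ℝ) (i : ℕ) : ℝ :=
  -∑' j : ℕ, bStar d a (j + 1) i

/-! ### The sequence space `l¹` -/

/-- The Banach space of absolutely summable real sequences. -/
abbrev L1 : Type := lp (fun _ : ℕ => ℝ) 1

lemma L1.hasSum (x : L1) : HasSum (fun i => |x i|) ‖x‖ := by
  have h := lp.hasSum_norm (p := 1) (by simp) x
  simpa using h

/-- Build an element of `l¹`. -/
def mkL1 (f : ℕ → ℝ) (hf : Summable f) : L1 :=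
  ⟨f, by
    apply memℓp_gen
    simpa using hf.abs⟩

@[simp] lemma mkL1_apply (f : ℕ → ℝ) (hf : Summable f) (i : ℕ) : mkL1 f hf i = f i := rfl

lemma norm_mkL1 (f : ℕ → ℝ) (hf : Summable f) : ‖mkL1 f hf‖ = ∑' i, |f i| :=
  (L1.hasSum (mkL1 f hf)).tsum_eq.symm

lemma norm_mkL1_nonneg (f : ℕ → ℝ) (hf : Summable f) (h : ∀ i, 0 ≤ f i) :
    ‖mkL1 f hf‖ = ∑' i, f i := by
  rw [norm_mkL1]; exact tsum_congr fun i => abs_of_nonneg (h i)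

lemma L1.summable (x : L1) : Summable (fun i => x i) := (L1.hasSum x).summable.of_abs

/-- Coordinate functional. -/
def evL (i : ℕ) : L1 →L[ℝ] ℝ :=
  LinearMap.mkContinuous
    { toFun := fun x => x i, map_add' := fun x y => rfl, map_smul' := fun c x => rfl } 1
    (fun x => by
      have := (le_hasSum (L1.hasSum x) i (fun j _ => abs_nonneg _))
      rw [one_mul]; exact this)

@[simp] lemma evL_apply (i : ℕ) (x : L1) : evL i x = x i := rfl

/-- Unit vectors. -/
def eV (j : ℕ) : L1 := lp.single 1 j (1 : ℝ)

lemma eV_apply (j i : ℕ) : eV j i = if i = j then 1 else 0 := by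
  rw [eV, lp.single_apply, Pi.single_apply]

lemma norm_eV (j : ℕ) : ‖eV j‖ = 1 := by
  have h := L1.hasSum (eV j)
  have h2 : HasSum (fun i => |eV j i|) 1 := by
    convert hasSum_ite_eq j (1 : ℝ) using 2 with i
    rw [eV_apply]; split_ifs <;> simp
  exact h.unique h2

lemma L1.hasSum_eV (x : L1) : HasSum (fun j => x j • eV j) x := by
  have := lp.hasSum_single (p := 1) (by simp) x
  refine this.congr_fun ?_ |> fun h => h
  intro j
  rw [eV, ← lp.single_smul]
  simp

/-- The operator on `l¹` with bounded columns. -/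
def ofCols (col : ℕ → L1) (C : ℝ) (h : ∀ j, ‖col j‖ ≤ C) : L1 →L[ℝ] L1 :=
  have hs : ∀ x : L1, Summable (fun j => x j • col j) := fun x => by
    refine Summable.of_norm_bounded ((L1.hasSum x).summable.mul_right C) fun j => ?_
    rw [norm_smul, Real.norm_eq_abs]
    exact mul_le_mul_of_nonneg_left (h j) (abs_nonneg _)
  LinearMap.mkContinuous
    { toFun := fun x => ∑' j, x j • col j
      map_add' := fun x y => by
        rw [← (hs x).tsum_add (hs y)]
        exact tsum_congr fun j => by rw [← add_smul]; rfl
      map_smul' := fun c x => by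
        rw [RingHom.id_apply, ← (hs x).tsum_const_smul]
        exact tsum_congr fun j => by rw [smul_smul]; rfl } C
    (fun x => by
      have h1 := (L1.hasSum x).mul_left C
      refine tsum_of_norm_bounded h1 fun j => ?_
      rw [norm_smul, Real.norm_eq_abs, mul_comm]
      exact mul_le_mul_of_nonneg_right (h j) (abs_nonneg _))

lemma ofCols_hasSum (col : ℕ → L1) (C : ℝ) (h : ∀ j, ‖col j‖ ≤ C) (x : L1) :
    HasSum (fun j => x j • col j) (ofCols col C h x) := by
  have hs : Summable (fun j => x j • col j) := by
    refine Summable.of_norm_bounded ((L1.hasSum x).summable.mul_right C) fun j => ?_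
    rw [norm_smul, Real.norm_eq_abs]
    exact mul_le_mul_of_nonneg_left (h j) (abs_nonneg _)
  exact hs.hasSum

lemma norm_ofCols_le (col : ℕ → L1) (C : ℝ) (h : ∀ j, ‖col j‖ ≤ C) : ‖ofCols col C h‖ ≤ C := by
  refine ContinuousLinearMap.opNorm_le_bound _ ((norm_nonneg _).trans (h 0)) fun x => ?_
  rw [← (ofCols_hasSum col C h x).tsum_eq]
  refine tsum_of_norm_bounded ((L1.hasSum x).mul_left C) fun j => ?_
  rw [norm_smul, Real.norm_eq_abs, mul_comm]
  exact mul_le_mul_of_nonneg_right (h j) (abs_nonneg _)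

lemma ofCols_apply (col : ℕ → L1) (C : ℝ) (h : ∀ j, ‖col j‖ ≤ C) (x : L1) (i : ℕ) :
    HasSum (fun j => x j * col j i) (ofCols col C h x i) := by
  have := (ofCols_hasSum col C h x).mapL (evL i)
  simpa using this

lemma ofCols_eV (col : ℕ → L1) (C : ℝ) (h : ∀ j, ‖col j‖ ≤ C) (j : ℕ) :
    ofCols col C h (eV j) = col j := by
  have h1 := ofCols_hasSum col C h (eV j)
  have h2 : HasSum (fun k => eV j k • col k) (col j) := by
    convert hasSum_ite_eq j (col j) using 2 with k
    rw [eV_apply]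
    by_cases hk : k = j
    · simp [hk]
    · simp [hk]
  exact h1.unique h2

lemma L1.clm_ext {S T : L1 →L[ℝ] L1} (h : ∀ j, S (eV j) = T (eV j)) : S = T := by
  ext1 x
  have h1 := (L1.hasSum_eV x).mapL S
  have h2 := (L1.hasSum_eV x).mapL T
  refine h1.unique (h2.congr_fun ?_)
  intro j
  simp [h]

/-! ### Abstract evolution bounds -/

lemma exists_evolution {E : Type*} [NormedAddCommGroup E] [NormedSpace ℝ E] [CompleteSpace E]
    (Q : E →L[ℝ] E) (K : ℝ) (hQ : ‖Q‖ ≤ K) (u : E) :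
    ∃ v : ℝ → E, v 0 = u ∧ (∀ t, HasDerivAt v (Q (v t)) t) ∧
      ∀ t, 0 ≤ t → ‖v t‖ ≤ ‖u‖ * Real.exp (K * t) := by
  have hd : ∀ t, HasDerivAt (fun t : ℝ => NormedSpace.exp (t • Q) u)
      (Q (NormedSpace.exp (t • Q) u)) t := by
    intro t
    have h1 := hasDerivAt_exp_smul_const' (𝕂 := ℝ) Q t
    have h2 := HasDerivAt.clm_apply h1 (hasDerivAt_const t u)
    simpa using h2
  refine ⟨fun t => NormedSpace.exp (t • Q) u, by simp, hd, fun t ht => ?_⟩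
  have := norm_le_gronwallBound_of_norm_deriv_right_le (f := fun t : ℝ => NormedSpace.exp (t • Q) u)
    (f' := fun t => Q (NormedSpace.exp (t • Q) u)) (δ := ‖u‖) (K := K) (ε := 0) (a := 0) (b := t)
    (fun s _ => (hd s).continuousAt.continuousWithinAt) (fun s _ => (hd s).hasDerivWithinAt)
    (by simp) (fun s _ => by
      rw [add_zero]
      exact (Q.le_opNorm _).trans (mul_le_mul_of_nonneg_right hQ (norm_nonneg _))) t ⟨ht, le_rfl⟩
  simpa [gronwallBound_ε0] using this

lemma exists_resolvent {E : Type*} [NormedAddCommGroup E] [NormedSpace ℝ E] [CompleteSpace E]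
    (Q : E →L[ℝ] E) (c α : ℝ) (hα : 0 < α) (hc : 0 < c) (hQ : ‖Q‖ ≤ c - α) (f : E) :
    ∃ u : E, c • u - Q u = f ∧ ‖u‖ ≤ ‖f‖ / α := by
  have hlt : ‖c⁻¹ • Q‖ < 1 := by
    rw [norm_smul, norm_inv, Real.norm_of_nonneg hc.le, inv_mul_lt_iff₀ hc]; linarith
  set U := Units.oneSub (c⁻¹ • Q) hlt with hU
  have hv : (U : E →L[ℝ] E) * ((U⁻¹ : (E →L[ℝ] E)ˣ) : E →L[ℝ] E) = 1 := U.mul_inv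
  set u : E := ((U⁻¹ : (E →L[ℝ] E)ˣ) : E →L[ℝ] E) (c⁻¹ • f) with hu
  have h1 : u - c⁻¹ • Q u = c⁻¹ • f := by
    have := congrArg (fun T : E →L[ℝ] E => T (c⁻¹ • f)) hv
    change (1 - c⁻¹ • Q) u = c⁻¹ • f at this
    simpa using this
  have h2 : c • u - Q u = f := by
    have := congrArg (fun x => c • x) h1
    simpa [smul_sub, smul_smul, hc.ne'] using this
  refine ⟨u, h2, ?_⟩
  rw [le_div_iff₀ hα, ← h2]
  have h3 : ‖c • u‖ - ‖Q u‖ ≤ ‖c • u - Q u‖ := norm_sub_norm_le _ _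
  rw [norm_smul, Real.norm_of_nonneg hc.le] at h3
  have h4 : ‖Q u‖ ≤ (c - α) * ‖u‖ := (Q.le_opNorm _).trans
    (mul_le_mul_of_nonneg_right hQ (norm_nonneg _))
  nlinarith

/-- If `P J = J Q` with `‖P‖ ≤ c`, `‖Q‖ ≤ c - α`, then an eigenvector `P x = c x` in the closure
of the range of `J` vanishes. -/
lemma eq_zero_of_fixed {E : Type*} [NormedAddCommGroup E] [NormedSpace ℝ E]
    (P Q J : E →L[ℝ] E) (c α : ℝ) (hα : 0 < α) (hc : 0 < c) (hP : ‖P‖ ≤ c) (hQ : ‖Q‖ ≤ c - α)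
    (hJ : ∀ v, P (J v) = J (Q v)) (x : E) (hx : P x = c • x)
    (hcl : ∀ ε > 0, ∃ v, ‖x - J v‖ ≤ ε) : x = 0 := by
  have hPn : ∀ n : ℕ, ∀ y, ‖(P ^ n) y‖ ≤ c ^ n * ‖y‖ := by
    intro n
    induction n with
    | zero => intro y; simp
    | succ n ih =>
      intro y
      rw [pow_succ', ContinuousLinearMap.mul_def, ContinuousLinearMap.comp_apply]
      calc _ ≤ ‖P‖ * ‖(P ^ n) y‖ := P.le_opNorm _
        _ ≤ c * (c ^ n * ‖y‖) := by gcongr; exact ih y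
        _ = _ := by ring
  have hQn : ∀ n : ℕ, ∀ y, ‖(Q ^ n) y‖ ≤ (c - α) ^ n * ‖y‖ := by
    intro n
    induction n with
    | zero => intro y; simp
    | succ n ih =>
      intro y
      rw [pow_succ', ContinuousLinearMap.mul_def, ContinuousLinearMap.comp_apply]
      have : 0 ≤ c - α := (norm_nonneg _).trans hQ
      calc _ ≤ ‖Q‖ * ‖(Q ^ n) y‖ := Q.le_opNorm _
        _ ≤ (c - α) * ((c - α) ^ n * ‖y‖) := by gcongr; exact ih y
        _ = _ := by ring
  have hJn : ∀ n : ℕ, ∀ v, (P ^ n) (J v) = J ((Q ^ n) v) := by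
    intro n
    induction n with
    | zero => intro y; simp
    | succ n ih =>
      intro y
      rw [pow_succ', ContinuousLinearMap.mul_def, ContinuousLinearMap.comp_apply, ih, hJ, pow_succ',
        ContinuousLinearMap.mul_def, ContinuousLinearMap.comp_apply]
  have hxn : ∀ n : ℕ, (P ^ n) x = c ^ n • x := by
    intro n
    induction n with
    | zero => simp
    | succ n ih =>
      rw [pow_succ', ContinuousLinearMap.mul_def, ContinuousLinearMap.comp_apply, ih, map_smul, hx, smul_smul, pow_succ]
  have hbd : ∀ v, ∀ n : ℕ, ‖x‖ ≤ ‖x - J v‖ + ‖J‖ * ‖v‖ * ((c - α) / c) ^ n := by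
    intro v n
    have h1 : c ^ n * ‖x‖ ≤ c ^ n * ‖x - J v‖ + ‖J‖ * ((c - α) ^ n * ‖v‖) := by
      calc c ^ n * ‖x‖ = ‖(P ^ n) x‖ := by
            rw [hxn, norm_smul, Real.norm_of_nonneg (by positivity)]
        _ = ‖(P ^ n) (x - J v) + J ((Q ^ n) v)‖ := by rw [map_sub, hJn]; simp
        _ ≤ ‖(P ^ n) (x - J v)‖ + ‖J ((Q ^ n) v)‖ := norm_add_le _ _
        _ ≤ _ := by
          refine add_le_add (hPn _ _) ((J.le_opNorm _).trans ?_)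
          gcongr
          exact hQn n v
    have hcn : 0 < c ^ n := by positivity
    have h2 : c ^ n * ((c - α) / c) ^ n = (c - α) ^ n := by
      rw [← mul_pow, mul_div_cancel₀ _ hc.ne']
    refine le_of_mul_le_mul_left ?_ hcn
    rw [mul_add, show c ^ n * (‖J‖ * ‖v‖ * ((c - α) / c) ^ n)
      = ‖J‖ * ‖v‖ * (c ^ n * ((c - α) / c) ^ n) by ring, h2]
    linarith
  have hle : ∀ v, ‖x‖ ≤ ‖x - J v‖ := by
    intro v
    have ht : Tendsto (fun n : ℕ => ‖x - J v‖ + ‖J‖ * ‖v‖ * ((c - α) / c) ^ n) atTop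
        (𝓝 (‖x - J v‖ + ‖J‖ * ‖v‖ * 0)) := by
      refine Tendsto.const_add _ (Tendsto.const_mul _ (tendsto_pow_atTop_nhds_zero_of_lt_one ?_ ?_))
      · exact div_nonneg ((norm_nonneg _).trans hQ) hc.le
      · rw [div_lt_one hc]; linarith
    have := ge_of_tendsto' ht (hbd v)
    simpa using this
  have : ‖x‖ ≤ 0 := le_of_forall_pos_le_add fun ε hε => by
    obtain ⟨v, hv⟩ := hcl ε hε
    have := hle v
    linarith
  simpa using this

/-! ### Means and tails -/

lemma mean_tail (f : ℕ → ℝ) (hf : ∀ i, 0 ≤ f i) (hs : Summable f)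
    (hT : Summable (fun k : ℕ => ∑' i, f (k + 1 + i))) :
    HasSum (fun j : ℕ => (j + 1 : ℝ) * f (j + 1)) (∑' k : ℕ, ∑' i, f (k + 1 + i)) := by
  have hrow : ∀ k : ℕ, Summable (fun i => f (k + 1 + i)) := fun k =>
    hs.comp_injective (add_right_injective (k + 1))
  have hprod : Summable (fun q : ℕ × ℕ => f (q.1 + 1 + q.2)) :=
    (summable_prod_of_nonneg (fun q => hf _)).2 ⟨hrow, hT⟩
  have h1 : HasSum (fun q : ℕ × ℕ => f (q.1 + 1 + q.2)) (∑' k : ℕ, ∑' i, f (k + 1 + i)) := by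
    have := hprod.tsum_prod
    rw [← this]; exact hprod.hasSum
  have h2 := (Finset.HasAntidiagonal.sigmaAntidiagonalEquivProd (A := ℕ)).hasSum_iff.2 h1
  have h3 := h2.sigma (g := fun j : ℕ => (j + 1 : ℝ) * f (j + 1)) (fun n => by
    have := hasSum_fintype (fun q : Finset.HasAntidiagonal.antidiagonal n => f (q.1.1 + 1 + q.1.2))
    rw [Finset.sum_coe_sort (Finset.HasAntidiagonal.antidiagonal n)
      (fun q => f (q.1 + 1 + q.2))] at this
    rw [Finset.sum_congr rfl (g := fun _ => f (n + 1))] at this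
    · simpa using this
    · intro q hq
      rw [Finset.HasAntidiagonal.mem_antidiagonal] at hq
      congr 1; omega)
  exact h3

/-! ### Uniqueness for the forward Kolmogorov system -/

lemma kolmogorov_unique (a : ℕ → ℕ → ℝ) (A : L1 →L[ℝ] L1)
    (hA : ∀ (x : L1) i, HasSum (fun j => a i j * x j) (A x i))
    (p : ℝ → ℕ → ℝ) (hp : IsKolmogorovSolution a p)
    (g : ℝ → L1) (hg : ∀ t, HasDerivAt g (A (g t)) t) (hg0 : ∀ i, g 0 i = p 0 i) :
    ∀ t, 0 ≤ t → ∀ i, g t i = p t i := by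
  obtain ⟨hst, hinteg⟩ := hp
  set X : ℝ → L1 := fun t => mkL1 (p (max t 0)) (hst _ (le_max_right _ _)).2.summable with hX
  have hXi : ∀ t i, 0 ≤ t → X t i = p t i := by
    intro t i ht
    simp only [hX, mkL1_apply, max_eq_left ht]
  have hXn : ∀ t, ‖X t‖ = 1 := by
    intro t
    have h := hst _ (le_max_right t 0)
    rw [hX]
    simp only
    rw [norm_mkL1_nonneg _ _ h.1]
    exact h.2.tsum_eq
  have hAn : ∀ t, ‖A (X t)‖ ≤ ‖A‖ := by
    intro t
    have := A.le_opNorm (X t)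
    rwa [hXn, mul_one] at this
  have hco : ∀ (x : L1) i, |x i| ≤ ‖x‖ := fun x i =>
    le_hasSum (L1.hasSum x) i (fun j _ => abs_nonneg _)
  have hk : ∀ i s t, 0 ≤ s → s ≤ t → X t i - X s i = ∫ u in s..t, A (X u) i := by
    intro i s t hs hst'
    rw [hXi t i (hs.trans hst'), hXi s i hs, hinteg i s t hs hst', add_sub_cancel_left]
    refine intervalIntegral.integral_congr fun u hu => ?_
    rw [Set.uIcc_of_le hst'] at hu
    have hu0 : 0 ≤ u := hs.trans hu.1
    have := (hA (X u) i).tsum_eq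
    simp only
    rw [← this]
    exact tsum_congr fun j => by rw [hXi u j hu0]
  -- extension to negative times
  have hmax : ∀ t, X t = X (max t 0) := by
    intro t
    apply lp.ext
    funext i
    simp [hX]
  have hlip1 : ∀ i, LipschitzWith (Real.toNNReal ‖A‖) (fun t => X t i) := by
    intro i
    have key : ∀ s t, 0 ≤ s → s ≤ t → |X t i - X s i| ≤ ‖A‖ * |t - s| := by
      intro s t hs hst'
      rw [hk i s t hs hst', ← Real.norm_eq_abs]
      exact intervalIntegral.norm_integral_le_of_norm_le_const fun u _ =>
        (hco _ _).trans (hAn u)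
    refine LipschitzWith.of_dist_le_mul fun s t => ?_
    rw [Real.coe_toNNReal _ (norm_nonneg _), Real.dist_eq, Real.dist_eq]
    have hm : |max s 0 - max t 0| ≤ |s - t| := abs_max_sub_max_le_abs s t 0
    rw [hmax s, hmax t]
    refine le_trans ?_ (mul_le_mul_of_nonneg_left hm (norm_nonneg A))
    rcases le_total (max s 0) (max t 0) with h | h
    · rw [abs_sub_comm, abs_sub_comm (max s 0)]
      exact key _ _ (le_max_right _ _) h
    · exact key _ _ (le_max_right _ _) h
  have hmeas : ∀ i, Measurable (fun u => A (X u) i) := by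
    intro i
    refine measurable_of_tendsto_metrizable (f := fun n u => ∑ j ∈ Finset.range n, a i j * X u j)
      (fun n => ?_) ?_
    · exact Finset.measurable_sum _ fun j _ => ((hlip1 j).continuous.measurable).const_mul _
    · rw [tendsto_pi_nhds]
      intro u
      exact (hA (X u) i).tendsto_sum_nat
  have hii : ∀ i s t, IntervalIntegrable (fun u => A (X u) i) volume s t := by
    intro i s t
    refine (intervalIntegrable_const (c := ‖A‖)).mono_fun (hmeas i).aestronglyMeasurable ?_
    refine Eventually.of_forall fun u => ?_
    rw [norm_norm]
    exact (hco _ _).trans (hAn u)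
  have hlip : LipschitzWith (Real.toNNReal ‖A‖) X := by
    have key : ∀ s t, 0 ≤ s → s ≤ t → ‖X t - X s‖ ≤ ‖A‖ * |t - s| := by
      intro s t hs hst'
      refine hasSum_le_of_sum_le (L1.hasSum (X t - X s)) fun S => ?_
      calc ∑ i ∈ S, |(X t - X s) i| = ∑ i ∈ S, |∫ u in s..t, A (X u) i| := by
            refine Finset.sum_congr rfl fun i _ => ?_
            rw [← hk i s t hs hst']; rfl
        _ ≤ ∑ i ∈ S, ∫ u in s..t, |A (X u) i| :=
            Finset.sum_le_sum fun i _ => intervalIntegral.abs_integral_le_integral_abs hst'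
        _ = ∫ u in s..t, ∑ i ∈ S, |A (X u) i| := by
            rw [intervalIntegral.integral_finsetSum]
            exact fun i _ => (hii i s t).abs
        _ ≤ ∫ u in s..t, ‖A‖ := by
            refine intervalIntegral.integral_mono_on hst' ?_ intervalIntegrable_const ?_
            · have := IntervalIntegrable.sum S (f := fun i u => |A (X u) i|) (μ := volume)
                (a := s) (b := t) (fun i _ => (hii i s t).abs)
              have he : (∑ i ∈ S, fun u => |A (X u) i|) = fun u => ∑ i ∈ S, |A (X u) i| := by
                funext u
                simp
              rw [he] at this
              exact this
            · intro u _
              exact (sum_le_hasSum S (fun _ _ => abs_nonneg _) (L1.hasSum (A (X u)))).trans (hAn u)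
        _ = ‖A‖ * |t - s| := by
            rw [intervalIntegral.integral_const, smul_eq_mul, abs_of_nonneg (sub_nonneg.2 hst'),
              mul_comm]
    refine LipschitzWith.of_dist_le_mul fun s t => ?_
    rw [Real.coe_toNNReal _ (norm_nonneg _), dist_eq_norm, Real.dist_eq]
    have hm : |max s 0 - max t 0| ≤ |s - t| := abs_max_sub_max_le_abs s t 0
    rw [hmax s, hmax t]
    refine le_trans ?_ (mul_le_mul_of_nonneg_left hm (norm_nonneg A))
    rcases le_total (max s 0) (max t 0) with h | h
    · rw [norm_sub_rev, abs_sub_comm (max s 0)]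
      exact key _ _ (le_max_right _ _) h
    · exact key _ _ (le_max_right _ _) h
  have hAX : Continuous (fun u => A (X u)) := A.continuous.comp hlip.continuous
  set Y : ℝ → L1 := fun t => X 0 + ∫ u in (0 : ℝ)..t, A (X u) with hY
  have hYX : ∀ t, 0 ≤ t → Y t = X t := by
    intro t ht
    apply lp.ext
    funext i
    have h1 : evL i (∫ u in (0 : ℝ)..t, A (X u)) = ∫ u in (0 : ℝ)..t, A (X u) i :=
      ((evL i).intervalIntegral_comp_comm (hAX.intervalIntegrable 0 t)).symm
    have h2 : Y t i = X 0 i + evL i (∫ u in (0 : ℝ)..t, A (X u)) := rfl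
    rw [h2, h1, ← hk i 0 t le_rfl ht]; ring
  have hYd : ∀ t, HasDerivAt Y (A (X t)) t := by
    intro t
    have := intervalIntegral.integral_hasDerivAt_right (hAX.intervalIntegrable 0 t)
      (hAX.stronglyMeasurableAtFilter _ _) hAX.continuousAt
    exact this.const_add (X 0)
  intro t ht i
  have huniq := ODE_solution_unique (v := fun _ x => A x) (K := ‖A‖₊) (f := g) (g := Y)
    (a := 0) (b := t) (fun _ => A.lipschitz)
    (fun s _ => (hg s).continuousAt.continuousWithinAt) (fun s _ => (hg s).hasDerivWithinAt)
    (fun s _ => (hYd s).continuousAt.continuousWithinAt)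
    (fun s hs => by
      rw [hYX s hs.1]
      exact (hYd s).hasDerivWithinAt)
    (by
      rw [hYX 0 le_rfl]
      apply lp.ext
      funext i
      rw [hg0, hXi 0 i le_rfl])
  have := huniq (Set.right_mem_Icc.2 ht)
  rw [this, hYX t ht, hXi t i ht]

/-! ### The matrix `D B D⁻¹` -/

/-- Column tails `Σ_{k ≥ i} a_{kj}`. -/
def colTail (a : ℕ → ℕ → ℝ) (i j : ℕ) : ℝ := ∑' k, a (i + k) j

lemma colTail_succ (a : ℕ → ℕ → ℝ) (hadiag : ∀ j, HasSum (fun i => a i j) 0) (i j : ℕ) :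
    colTail a i j = a i j + colTail a (i + 1) j := by
  have hs : Summable (fun k => a (i + k) j) :=
    (hadiag j).summable.comp_injective (add_right_injective i)
  rw [colTail, hs.tsum_eq_zero_add, colTail, add_zero]
  congr 1
  exact tsum_congr fun k => by rw [add_right_comm, add_assoc]

lemma colTail_zero (a : ℕ → ℕ → ℝ) (hadiag : ∀ j, HasSum (fun i => a i j) 0) (j : ℕ) :
    colTail a 0 j = 0 := by
  rw [colTail, ← (hadiag j).tsum_eq]
  exact tsum_congr fun k => by rw [zero_add]

lemma bStar_eq (d : ℕ → ℝ) (a : ℕ → ℕ → ℝ) (hadiag : ∀ j, HasSum (fun i => a i j) 0) (i j : ℕ) :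
    bStar d a i (j + 1) = d i / d (j + 1) * (colTail a i (j + 1) - colTail a i j) := by
  have hs : ∀ j, Summable (fun k => a (i + k) j) := fun j =>
    (hadiag j).summable.comp_injective (add_right_injective i)
  rw [bStar, colTail, colTail, ← (hs (j + 1)).tsum_sub (hs j)]
  congr 1
  refine tsum_congr fun k => ?_
  rw [bEntry, bEntry, if_neg (Nat.succ_ne_zero j), Nat.add_sub_cancel]
  by_cases hj : j = 0
  · subst hj; simp
  · rw [if_neg hj]; ring

lemma colTail_nonneg (a : ℕ → ℕ → ℝ) (haoff : ∀ i j, i ≠ j → 0 ≤ a i j) (i j : ℕ) (h : j < i) :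
    0 ≤ colTail a i j := tsum_nonneg fun k => haoff _ _ (by omega)

lemma colTail_diag_nonpos (a : ℕ → ℕ → ℝ) (haoff : ∀ i j, i ≠ j → 0 ≤ a i j)
    (hadiag : ∀ j, HasSum (fun i => a i j) 0) (j : ℕ) : ∀ i, i ≤ j → colTail a i j ≤ 0 := by
  intro i
  induction i with
  | zero => intro _; exact (colTail_zero a hadiag j).le
  | succ i ih =>
    intro h
    have h1 := ih (by omega)
    have h2 := colTail_succ a hadiag i j
    have h3 := haoff i j (by omega)
    linarith

lemma bStar_diag_ge (d : ℕ → ℝ) (a : ℕ → ℕ → ℝ) (L : ℝ) (hdpos : ∀ k, 1 ≤ k → 0 < d k)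
    (haoff : ∀ i j, i ≠ j → 0 ≤ a i j)
    (hadiag : ∀ j, HasSum (fun i => a i j) 0) (haL : ∀ j, |a j j| ≤ L) (j : ℕ) :
    -(2 * L) ≤ bStar d a (j + 1) (j + 1) := by
  rw [bStar_eq d a hadiag, div_self (hdpos _ (by omega)).ne', one_mul]
  have h1 := colTail_succ a hadiag (j + 1) (j + 1)
  have h2 := colTail_nonneg a haoff (j + 1 + 1) (j + 1) (by omega)
  have h3 := colTail_succ a hadiag j j
  have h4 := colTail_diag_nonpos a haoff hadiag j j le_rfl
  have h5 := abs_le.1 (haL (j + 1))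
  have h6 := abs_le.1 (haL j)
  linarith

/-- The operator `J` recovering a sum-zero sequence from its weighted tails. -/
def Jop (d : ℕ → ℝ) (hd : ∀ k, 1 ≤ d (k + 1)) : L1 →L[ℝ] L1 :=
  ofCols (fun k => (d (k + 1))⁻¹ • (eV (k + 1) - eV k)) 2 (fun k => by
    rw [norm_smul]
    have h1 : ‖(d (k + 1))⁻¹‖ ≤ 1 := by
      rw [norm_inv, Real.norm_of_nonneg (by linarith [hd k])]
      exact inv_le_one_of_one_le₀ (hd k)
    have h2 : ‖eV (k + 1) - eV k‖ ≤ 2 := by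
      refine (norm_sub_le _ _).trans ?_
      rw [norm_eV, norm_eV]; norm_num
    calc _ ≤ 1 * 2 := mul_le_mul h1 h2 (norm_nonneg _) zero_le_one
      _ = 2 := by norm_num)

lemma Jop_eV (d : ℕ → ℝ) (hd : ∀ k, 1 ≤ d (k + 1)) (k : ℕ) :
    Jop d hd (eV k) = (d (k + 1))⁻¹ • (eV (k + 1) - eV k) := ofCols_eV _ _ _ _

lemma Jop_apply_succ (d : ℕ → ℝ) (hd : ∀ k, 1 ≤ d (k + 1)) (u : L1) (i : ℕ) :
    Jop d hd u (i + 1) = u i / d (i + 1) - u (i + 1) / d (i + 1 + 1) := by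
  refine (ofCols_apply _ _ _ u (i + 1)).unique ?_
  have h1 := hasSum_ite_eq i (u i / d (i + 1))
  have h2 := hasSum_ite_eq (i + 1) (u (i + 1) / d (i + 1 + 1))
  refine (h1.sub h2).congr_fun ?_
  intro k
  simp only [lp.coeFn_smul, lp.coeFn_sub, Pi.smul_apply, Pi.sub_apply, eV_apply, smul_eq_mul]
  by_cases hk : k = i
  · subst hk; simp [div_eq_mul_inv]
  · by_cases hk' : k = i + 1
    · subst hk'; simp [div_eq_mul_inv]
    · have e1 : ¬ i = k := fun h => hk h.symm
      have e2 : ¬ i + 1 = k := fun h => hk' h.symm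
      simp [hk, hk', e1, e2]

lemma Jop_apply_zero (d : ℕ → ℝ) (hd : ∀ k, 1 ≤ d (k + 1)) (u : L1) :
    Jop d hd u 0 = -(u 0 / d 1) := by
  refine (ofCols_apply _ _ _ u 0).unique ?_
  refine (hasSum_ite_eq 0 (-(u 0 / d 1))).congr_fun ?_
  intro k
  simp only [lp.coeFn_smul, lp.coeFn_sub, Pi.smul_apply, Pi.sub_apply, eV_apply, smul_eq_mul]
  by_cases hk : k = 0
  · subst hk; simp [div_eq_mul_inv]
  · have e1 : ¬ 0 = k := fun h => hk h.symm
    simp [hk, e1]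

/-- Sequences of total mass zero lie in the closure of the range of `J`. -/
lemma Jop_dense (d : ℕ → ℝ) (hd : ∀ k, 1 ≤ d (k + 1)) (x : L1) (hx : HasSum (fun i => x i) 0) :
    ∀ ε > 0, ∃ v, ‖x - Jop d hd v‖ ≤ ε := by
  have hmem : ∀ j, eV j - eV 0 ∈ (Jop d hd).range := by
    intro j
    induction j with
    | zero => simp
    | succ j ih =>
      have h1 : eV (j + 1) - eV j ∈ (Jop d hd).range := by
        refine ⟨d (j + 1) • eV j, ?_⟩
        have : d (j + 1) ≠ 0 := by linarith [hd j]
        change Jop d hd (d (j + 1) • eV j) = _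
        rw [map_smul, Jop_eV, smul_smul, mul_inv_cancel₀ this, one_smul]
      have := Submodule.add_mem _ h1 ih
      simpa using this
  have hs : HasSum (fun j => x j • (eV j - eV 0)) x := by
    have h1 := (L1.hasSum_eV x).sub (hx.smul_const (eV 0))
    simpa [smul_sub] using h1
  have hcl : x ∈ closure ((Jop d hd).range : Set L1) := by
    refine mem_closure_of_tendsto hs (Eventually.of_forall fun S => ?_)
    exact Submodule.sum_mem _ fun j _ => Submodule.smul_mem _ _ (hmem j)
  intro ε hε
  obtain ⟨y, ⟨v, rfl⟩, hv⟩ := Metric.mem_closure_iff.1 hcl ε hε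
  refine ⟨v, ?_⟩
  rw [← dist_eq_norm]
  exact hv.le

/-- Tails of `J u`. -/
lemma Jop_tail (d : ℕ → ℝ) (hd : ∀ k, 1 ≤ d (k + 1)) (u : L1) (k : ℕ) :
    ∑' i, Jop d hd u (k + 1 + i) = u k / d (k + 1) := by
  have hs : Summable (fun i => Jop d hd u (k + 1 + i)) :=
    (L1.summable _).comp_injective (add_right_injective (k + 1))
  have hpart : ∀ n, ∑ i ∈ Finset.range n, Jop d hd u (k + 1 + i)
      = u k / d (k + 1) - u (k + n) / d (k + n + 1) := by
    intro n
    induction n with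
    | zero => simp
    | succ n ih =>
      rw [Finset.sum_range_succ, ih, show k + 1 + n = k + n + 1 by ring, Jop_apply_succ,
        show k + (n + 1) = k + n + 1 by ring]
      ring
  have hz : Tendsto (fun n => u (k + n) / d (k + n + 1)) atTop (𝓝 0) := by
    have h1 : Tendsto (fun n => |u (k + n)|) atTop (𝓝 0) :=
      ((L1.hasSum u).summable.comp_injective (add_right_injective k)).tendsto_atTop_zero
    refine squeeze_zero_norm (fun n => ?_) h1
    rw [norm_div, Real.norm_eq_abs]
    refine div_le_self (abs_nonneg _) ?_
    rw [Real.norm_of_nonneg (by linarith [hd (k + n)])]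
    exact hd _
  have ht := hs.hasSum.tendsto_sum_nat
  simp only [hpart] at ht
  have := tendsto_nhds_unique ht (hz.const_sub _)
  simpa using this

/-- Corollary 1, bound (cor002).  For a homogeneous chain with
nonnegative off-diagonal entries of `D B D⁻¹`, `α = inf_i α_i > 0`, and
`W* = inf_{k≥1} (d_1 + ⋯ + d_k)/k > 0`, let `π` be a stationary stochastic vector,
`F = Σ_{k≥1} d_k Σ_{i≥k} a_{i0} < ∞`, `φ = Σ_{j≥1} j·π_j` the stationary mean, and `p`
the solution with `p(0) = e_0`, with mean `E(t,0) = Σ_{j≥1} j·p_j(t)`.  Then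
`|φ − E(t,0)| ≤ (F/(α·W*))·e^{−αt}` for all `t ≥ 0`. -/
theorem cor1_cor002
    (a : ℕ → ℕ → ℝ) (d : ℕ → ℝ) (L : ℝ)
    (hd1 : d 1 = 1) (hdpos : ∀ k, 1 ≤ k → 0 < d k)
    (hdmono : ∀ k, 1 ≤ k → d k ≤ d (k + 1))
    (haoff : ∀ i j, i ≠ j → 0 ≤ a i j)
    (hadiag : ∀ j, HasSum (fun i => a i j) 0)
    (haL : ∀ j, |a j j| ≤ L)
    (hbstar : ∀ i j, 1 ≤ i → 1 ≤ j → i ≠ j → 0 ≤ bStar d a i j)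
    (α : ℝ) (hα : α = ⨅ i : ℕ, alphaI d a (i + 1)) (hαpos : 0 < α)
    (Wstar : ℝ)
    (hWstar : Wstar = ⨅ k : ℕ, (∑ j ∈ Finset.range (k + 1), d (j + 1)) / (k + 1))
    (hWstarpos : 0 < Wstar)
    (F : ℝ) (hF : F = ∑' k : ℕ, d (k + 1) * ∑' i : ℕ, a (k + 1 + i) 0)
    (hFfin : Summable (fun k : ℕ => d (k + 1) * ∑' i : ℕ, a (k + 1 + i) 0))
    (π : ℕ → ℝ) (hπpos : ∀ i, 0 ≤ π i) (hπsum : HasSum π 1)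
    (hπstat : ∀ i, HasSum (fun j => a i j * π j) 0)
    (hφ : Summable (fun j : ℕ => (j + 1 : ℝ) * π (j + 1)))
    (p : ℝ → ℕ → ℝ) (hp : IsKolmogorovSolution a p)
    (hp0 : ∀ i : ℕ, p 0 i = if i = 0 then 1 else 0) :
    ∀ t : ℝ, 0 ≤ t →
      |(∑' j : ℕ, (j + 1 : ℝ) * π (j + 1)) - ∑' j : ℕ, (j + 1 : ℝ) * p t (j + 1)| ≤
        (F / (α * Wstar)) * Real.exp (-α * t) := by
  have hd : ∀ k, 1 ≤ d (k + 1) := by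
    intro k
    induction k with
    | zero => exact hd1.ge
    | succ k ih => exact ih.trans (hdmono (k + 1) (by omega))
  have hdp : ∀ k, 0 < d (k + 1) := fun k => hdpos _ (by omega)
  have hL : 0 ≤ L := (abs_nonneg _).trans (haL 0)
  set c : ℝ := 2 * L + 1 with hc_def
  have hc : 0 < c := by positivity
  -- the infimum defining `α` is genuine
  have hαle : ∀ i, α ≤ alphaI d a (i + 1) := by
    have hb : BddBelow (Set.range fun i : ℕ => alphaI d a (i + 1)) := by
      by_contra hb
      rw [Real.iInf_of_not_bddBelow hb] at hα
      exact hαpos.ne' hα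
    intro i
    rw [hα]
    exact ciInf_le hb i
  have hbsum : ∀ j, HasSum (fun i => bStar d a (i + 1) (j + 1)) (-alphaI d a (j + 1)) := by
    intro j
    have hs : Summable (fun i => bStar d a (i + 1) (j + 1)) := by
      by_contra hs
      have h1 := hαle j
      rw [alphaI, tsum_eq_zero_of_not_summable hs] at h1
      linarith
    rw [alphaI, neg_neg]
    exact hs.hasSum
  have hδ : ∀ j : ℕ, HasSum (fun i : ℕ => if i = j then c else 0) c := fun j =>
    hasSum_ite_eq j c
  -- the operators `P = A + c` and `Q = D B D⁻¹ + c`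
  have hPsum : ∀ j, HasSum (fun i => a i j + if i = j then c else 0) c := fun j => by
    simpa using (hadiag j).add (hδ j)
  have hPnn : ∀ j i, 0 ≤ a i j + if i = j then c else 0 := by
    intro j i
    by_cases h : i = j
    · subst h
      have := abs_le.1 (haL i)
      simp only [if_true]
      linarith
    · rw [if_neg h, add_zero]; exact haoff i j h
  have hQsum : ∀ j, HasSum (fun i => bStar d a (i + 1) (j + 1) + if i = j then c else 0)
      (-alphaI d a (j + 1) + c) := fun j => (hbsum j).add (hδ j)
  have hQnn : ∀ j i, 0 ≤ bStar d a (i + 1) (j + 1) + if i = j then c else 0 := by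
    intro j i
    by_cases h : i = j
    · subst h
      have := bStar_diag_ge d a L hdpos haoff hadiag haL i
      simp only [if_true]
      linarith
    · rw [if_neg h, add_zero]
      exact hbstar _ _ (by omega) (by omega) (by omega)
  have hPn : ∀ j, ‖mkL1 _ (hPsum j).summable‖ ≤ c := fun j => by
    rw [norm_mkL1_nonneg _ _ (hPnn j), (hPsum j).tsum_eq]
  have hQn : ∀ j, ‖mkL1 _ (hQsum j).summable‖ ≤ c - α := fun j => by
    rw [norm_mkL1_nonneg _ _ (hQnn j), (hQsum j).tsum_eq]
    linarith [hαle j]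
  set P : L1 →L[ℝ] L1 := ofCols (fun j => mkL1 _ (hPsum j).summable) c hPn with hPdef
  set Q : L1 →L[ℝ] L1 := ofCols (fun j => mkL1 _ (hQsum j).summable) (c - α) hQn with hQdef
  have hPle : ‖P‖ ≤ c := norm_ofCols_le _ _ _
  have hQle : ‖Q‖ ≤ c - α := norm_ofCols_le _ _ _
  set J : L1 →L[ℝ] L1 := Jop d hd with hJdef
  set A : L1 →L[ℝ] L1 := P - c • ContinuousLinearMap.id ℝ L1 with hAdef
  have hAx : ∀ x, A x = P x - c • x := fun x => rfl
  have hA : ∀ (x : L1) i, HasSum (fun j => a i j * x j) (A x i) := by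
    intro x i
    have h1 := ofCols_apply _ _ hPn x i
    have h2 := hasSum_ite_eq i (c * x i)
    have h3 := h1.sub h2
    have e : A x i = P x i - c * x i := rfl
    rw [e]
    refine h3.congr_fun ?_
    intro j
    simp only [mkL1_apply]
    by_cases h : j = i
    · subst h; simp; ring
    · have h' : ¬ i = j := fun q => h q.symm
      simp [h, h']; ring
  have hPJ : P.comp J = J.comp Q := by
    apply L1.clm_ext
    intro j
    rw [ContinuousLinearMap.comp_apply, ContinuousLinearMap.comp_apply, hJdef, Jop_eV, map_smul,
      map_sub, hPdef, hQdef, ofCols_eV, ofCols_eV, ofCols_eV]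
    apply lp.ext
    funext i
    have hdj := (hdp j).ne'
    cases i with
    | zero =>
      rw [Jop_apply_zero]
      simp only [lp.coeFn_smul, lp.coeFn_sub, Pi.smul_apply, Pi.sub_apply, mkL1_apply, smul_eq_mul,
        bStar_eq d a hadiag]
      have h1 := colTail_succ a hadiag 0 (j + 1)
      have h2 := colTail_succ a hadiag 0 j
      rw [colTail_zero a hadiag] at h1 h2
      have e1 : a 0 (j + 1) = - colTail a (0 + 1) (j + 1) := by linarith
      have e2 : a 0 j = - colTail a (0 + 1) j := by linarith
      rw [e1, e2]
      by_cases h : 0 = j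
      · subst h; simp [hd1]; ring
      · simp [h, hd1]; field_simp; ring
    | succ i =>
      rw [Jop_apply_succ]
      simp only [lp.coeFn_smul, lp.coeFn_sub, Pi.smul_apply, Pi.sub_apply, mkL1_apply, smul_eq_mul,
        bStar_eq d a hadiag]
      have h1 := colTail_succ a hadiag (i + 1) (j + 1)
      have h2 := colTail_succ a hadiag (i + 1) j
      have e1 : a (i + 1) (j + 1) =
        colTail a (i + 1) (j + 1) - colTail a (i + 1 + 1) (j + 1) := by linarith
      have e2 : a (i + 1) j = colTail a (i + 1) j - colTail a (i + 1 + 1) j := by linarith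
      rw [e1, e2]
      have hdi := (hdp i).ne'
      have hdi' := (hdp (i + 1)).ne'
      by_cases h : i = j
      · subst h
        simp
        field_simp
        ring
      · by_cases h' : i + 1 = j
        · subst h'
          simp
          field_simp
          ring
        · simp [h, h']
          field_simp
          ring
  have hPJ' : ∀ v, P (J v) = J (Q v) := fun v =>
    congrArg (fun T : L1 →L[ℝ] L1 => T v) hPJ
  -- the forcing vector
  have hfnn : ∀ k, 0 ≤ d (k + 1) * ∑' i : ℕ, a (k + 1 + i) 0 := fun k =>
    mul_nonneg (hdp k).le (tsum_nonneg fun i => haoff _ _ (by omega))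
  set f : L1 := mkL1 _ hFfin with hf
  have hfn : ‖f‖ = F := by rw [hf, norm_mkL1_nonneg _ _ hfnn, hF]
  have hF0 : 0 ≤ F := hfn ▸ norm_nonneg _
  have hJf : J f = A (eV 0) := by
    have e0 : A (eV 0) = P (eV 0) - c • eV 0 := rfl
    rw [e0, hPdef, ofCols_eV]
    apply lp.ext
    funext i
    cases i with
    | zero =>
      rw [hJdef, Jop_apply_zero]
      simp only [hf, lp.coeFn_smul, lp.coeFn_sub, Pi.smul_apply, Pi.sub_apply, mkL1_apply,
        smul_eq_mul, eV_apply]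
      have h1 := colTail_succ a hadiag 0 0
      rw [colTail_zero a hadiag, colTail] at h1
      simp only [zero_add, hd1, if_true] at h1 ⊢
      linarith
    | succ i =>
      rw [hJdef, Jop_apply_succ]
      simp only [hf, lp.coeFn_smul, lp.coeFn_sub, Pi.smul_apply, Pi.sub_apply, mkL1_apply,
        smul_eq_mul, eV_apply]
      have h1 := colTail_succ a hadiag (i + 1) 0
      rw [colTail, colTail] at h1
      rw [mul_div_cancel_left₀ _ (hdp i).ne', mul_div_cancel_left₀ _ (hdp (i + 1)).ne']
      simp
      linarith
  obtain ⟨u0, hu0, hu0n⟩ := exists_resolvent Q c α hαpos hc hQle f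
  rw [hfn] at hu0n
  set π' : L1 := eV 0 + J u0 with hπ'
  have hAπ' : A π' = 0 := by
    have h1 : A (J u0) = - J f := by
      rw [hAx, hPJ', ← map_smul, ← map_sub, ← map_neg]
      congr 1
      rw [← hu0]; abel
    rw [hπ', map_add, h1, hJf]; abel
  -- identification with the given stationary vector
  set πv : L1 := mkL1 π hπsum.summable with hπv
  have hAπ : A πv = 0 := by
    apply lp.ext
    funext i
    exact (hA πv i).unique (hπstat i)
  have hmass : ∀ v : L1, HasSum (fun i => J v i) 0 := by
    intro v
    have hs := L1.summable (J v)
    have h1 := hs.tsum_eq_zero_add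
    have h2 := Jop_tail d hd v 0
    have h3 : ∑' i, J v (i + 1) = v 0 / d 1 := by
      rw [show v 0 / d 1 = v 0 / d (0 + 1) by rfl, ← h2]
      exact tsum_congr fun i => by rw [zero_add, add_comm]
    rw [h3, hJdef, Jop_apply_zero, neg_add_cancel] at h1
    rw [← h1]
    exact hs.hasSum
  have hπeq : πv - π' = 0 := by
    refine eq_zero_of_fixed P Q J c α hαpos hc hPle hQle hPJ' _ ?_ ?_
    · have h1 : A (πv - π') = 0 := by rw [map_sub, hAπ, hAπ', sub_zero]
      rw [hAx] at h1
      exact sub_eq_zero.1 h1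
    · refine Jop_dense d hd _ ?_
      have h0 : HasSum (fun i => eV 0 i) 1 := by
        simp only [eV_apply]
        exact hasSum_ite_eq 0 1
      have := hπsum.sub (h0.add (hmass u0))
      rw [add_zero, sub_self] at this
      exact this
  -- the explicit solution
  obtain ⟨v, hv0, hvd, hvn⟩ := exists_evolution Q (c - α) hQle u0
  set w : ℝ → L1 := fun t => Real.exp (-c * t) • v t with hw
  have hwd : ∀ t, HasDerivAt w (Q (w t) - c • w t) t := by
    intro t
    have h1 : HasDerivAt (fun t => Real.exp (-c * t)) (Real.exp (-c * t) * (-c)) t := by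
      have := ((hasDerivAt_id t).const_mul (-c)).exp
      simpa using this
    have h2 := h1.smul (hvd t)
    refine h2.congr_deriv ?_
    rw [hw]
    simp only [map_smul, smul_smul]
    rw [mul_neg, neg_smul, mul_comm c]
    abel
  set g : ℝ → L1 := fun t => π' - J (w t) with hg
  have hgd : ∀ t, HasDerivAt g (A (g t)) t := by
    intro t
    have h1 := (J.hasFDerivAt.comp_hasDerivAt t (hwd t)).const_sub π'
    refine h1.congr_deriv ?_
    rw [hg]
    simp only
    rw [map_sub A, hAπ', zero_sub, hAx, hPJ', map_sub, map_smul J c]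
  have hg0 : ∀ i, g 0 i = p 0 i := by
    intro i
    have : g 0 = eV 0 := by
      simp [hg, hw, hv0, hπ']
    rw [this, hp0, eV_apply]
  intro t ht
  have hgp := kolmogorov_unique a A hA p hp g hgd hg0 t ht
  have hdiff : ∀ i, π i - p t i = J (w t) i := by
    intro i
    rw [← hgp i]
    have h1 : πv = π' := sub_eq_zero.1 hπeq
    have h2 : π i = π' i := by rw [← h1]; rfl
    rw [h2]
    have h3 : g t i = π' i - J (w t) i := rfl
    rw [h3]; ring
  have hwn : ‖w t‖ ≤ F / α * Real.exp (-α * t) := by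
    have h1 := hvn t ht
    rw [hw]
    simp only
    rw [norm_smul, Real.norm_of_nonneg (Real.exp_pos _).le]
    calc Real.exp (-c * t) * ‖v t‖
        ≤ Real.exp (-c * t) * (F / α * Real.exp ((c - α) * t)) := by
          gcongr
          refine h1.trans ?_
          gcongr
      _ = F / α * (Real.exp (-c * t) * Real.exp ((c - α) * t)) := by ring
      _ = F / α * Real.exp (-α * t) := by
          rw [← Real.exp_add]; congr 2; ring
  -- tails
  have htail : ∀ u : L1, ∀ k, |u k / d (k + 1)| ≤ |u k| := by
    intro u k
    rw [abs_div, abs_of_pos (hdp k)]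
    exact div_le_self (abs_nonneg _) (hd k)
  have htsum : ∀ u : L1, Summable (fun k => u k / d (k + 1)) := fun u =>
    Summable.of_norm_bounded (L1.hasSum u).summable (htail u)
  have hps := hp.1 t ht
  have hrow : ∀ q : ℕ → ℝ, Summable q → ∀ k : ℕ, Summable (fun i => q (k + 1 + i)) :=
    fun q hq k => hq.comp_injective (add_right_injective (k + 1))
  have hπT : ∀ k, ∑' i, π (k + 1 + i) = u0 k / d (k + 1) := by
    intro k
    rw [← Jop_tail d hd u0 k]
    refine tsum_congr fun i => ?_
    have h1 : πv = π' := sub_eq_zero.1 hπeq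
    have h2 : π (k + 1 + i) = π' (k + 1 + i) := by rw [← h1]; rfl
    have h3 : π' (k + 1 + i) = eV 0 (k + 1 + i) + J u0 (k + 1 + i) := rfl
    have h4 : eV 0 (k + 1 + i) = 0 := by
      rw [eV_apply, if_neg (by omega)]
    rw [h2, h3, h4, zero_add]
  have hpT : ∀ k, ∑' i, p t (k + 1 + i) = u0 k / d (k + 1) - w t k / d (k + 1) := by
    intro k
    rw [← hπT k, ← Jop_tail d hd (w t) k]
    have h1 : ∑' i, Jop d hd (w t) (k + 1 + i)
        = ∑' i, π (k + 1 + i) - ∑' i, p t (k + 1 + i) := by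
      rw [← (hrow π hπsum.summable k).tsum_sub (hrow _ hps.2.summable k)]
      exact tsum_congr fun i => (hdiff _).symm
    rw [h1]; ring
  have hmπ := mean_tail π hπpos hπsum.summable (by
    simp only [hπT]; exact htsum u0)
  have hmp := mean_tail (p t) hps.1 hps.2.summable (by
    simp only [hpT]; exact (htsum u0).sub (htsum (w t)))
  rw [hmπ.tsum_eq, hmp.tsum_eq]
  simp only [hπT, hpT]
  rw [(htsum u0).tsum_sub (htsum (w t)), sub_sub_cancel]
  have hfin : |∑' k, w t k / d (k + 1)| ≤ ‖w t‖ := by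
    rw [← Real.norm_eq_abs]
    exact tsum_of_norm_bounded (L1.hasSum (w t)) (htail (w t))
  refine (hfin.trans hwn).trans ?_
  have hW1 : Wstar ≤ 1 := by
    rw [hWstar]
    refine (ciInf_le ⟨0, ?_⟩ 0).trans ?_
    · rintro _ ⟨k, rfl⟩
      exact div_nonneg (Finset.sum_nonneg fun j _ => (hdp j).le) (by positivity)
    · simp [hd1]
  refine mul_le_mul_of_nonneg_right ?_ (Real.exp_pos _).le
  refine div_le_div_of_nonneg_left hF0 (mul_pos hαpos hWstarpos) ?_
  nlinarith
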